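/- arXiv:2105.14691 — 7 statements merged into one kernel-verified Lean document; each statement's English description precedes it below -/
import Mathlib

section
/- Let n > p ≥ 1 be integers and let M be a real n×n positive semidefinite matrix of rank p whose first p columns are linearly independent. Then there exists a unique real n×p matrix N such that N_{ij} = 0 whenever i < j, N_{ii} > 0 for all i = 1,…,p, and M = N Nᵀ. -/
open Matrix BigOperators

/-- The first `p` columns of the square matrix `M` are linearly independent. -/
def FirstColsIndep (n p : ℕ) (M : Matrix (Fin n) (Fin n) ℝ) : Prop :=
  LinearIndependent ℝ (fun j : {j : Fin n // (j : ℕ) < p} => (fun i : Fin n => M i j.1))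

/-- Membership in `S(n,p)`: real `n×n` positive semidefinite of rank `p`. -/
def MemS (n p : ℕ) (M : Matrix (Fin n) (Fin n) ℝ) : Prop :=
  M.PosSemidef ∧ M.rank = p

/-- Membership in `S(n,p)*`: in `S(n,p)` with first `p` columns linearly independent. -/
def MemSStar (n p : ℕ) (M : Matrix (Fin n) (Fin n) ℝ) : Prop :=
  MemS n p M ∧ FirstColsIndep n p M

/-- `N` is mock lower triangular: `N i j = 0` whenever `i < j`. -/
def MockLower (n p : ℕ) (N : Matrix (Fin n) (Fin p) ℝ) : Prop :=
  ∀ (i : Fin n) (j : Fin p), (i : ℕ) < (j : ℕ) → N i j = 0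

/-- Membership in `L^{n×p}_*`: mock lower triangular with positive mock diagonal. -/
def MemL (n p : ℕ) (N : Matrix (Fin n) (Fin p) ℝ) : Prop :=
  MockLower n p N ∧ ∀ (i : Fin n) (j : Fin p), (i : ℕ) = (j : ℕ) → 0 < N i j

/-- Frobenius norm of a square matrix. -/
noncomputable def frobNorm (n : ℕ) (A : Matrix (Fin n) (Fin n) ℝ) : ℝ :=
  Real.sqrt (∑ i : Fin n, ∑ j : Fin n, (A i j) ^ 2)

/-- The distance `d̃` on `L^{n×p}_*`. -/
noncomputable def dL (n p : ℕ) (N K : Matrix (Fin n) (Fin p) ℝ) : ℝ :=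
  Real.sqrt ((∑ i : Fin n, ∑ j : Fin p, if (j : ℕ) < (i : ℕ) then (N i j - K i j) ^ 2 else 0)
    + ∑ i : Fin n, ∑ j : Fin p, if (i : ℕ) = (j : ℕ)
        then (Real.log (N i j) - Real.log (K i j)) ^ 2 else 0)

/-- The group operation `⊕` on `L^{n×p}_*`. -/
noncomputable def oplus (n p : ℕ) (N K : Matrix (Fin n) (Fin p) ℝ) : Matrix (Fin n) (Fin p) ℝ :=
  fun i j => if (i : ℕ) = (j : ℕ) then N i j * K i j else N i j + K i j

/-- The identity `I_{n×p}` of `(L^{n×p}_*, ⊕)`. -/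
noncomputable def oneL (n p : ℕ) : Matrix (Fin n) (Fin p) ℝ :=
  fun i j => if (i : ℕ) = (j : ℕ) then 1 else 0

/-- The `⊕`-inverse on `L^{n×p}_*`. -/
noncomputable def invL (n p : ℕ) (N : Matrix (Fin n) (Fin p) ℝ) : Matrix (Fin n) (Fin p) ℝ :=
  fun i j => if (i : ℕ) = (j : ℕ) then (N i j)⁻¹ else -(N i j)

/-- The geodesic `γ` of `d̃` joining `N` to `K`. -/
noncomputable def geo (n p : ℕ) (N K : Matrix (Fin n) (Fin p) ℝ) (t : ℝ) :
    Matrix (Fin n) (Fin p) ℝ :=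
  fun i j => if (i : ℕ) = (j : ℕ) then (N i j) ^ (1 - t) * (K i j) ^ t
    else (1 - t) * N i j + t * K i j

/-- The exponential map `Exp_N` on `L^{n×p}_*`. -/
noncomputable def expMap (n p : ℕ) (N X : Matrix (Fin n) (Fin p) ℝ) :
    Matrix (Fin n) (Fin p) ℝ :=
  fun i j => if (i : ℕ) = (j : ℕ) then N i j * Real.exp (X i j / N i j) else N i j + X i j

/-- The logarithm map `Log_N` on `L^{n×p}_*`. -/
noncomputable def logMap (n p : ℕ) (N K : Matrix (Fin n) (Fin p) ℝ) :
    Matrix (Fin n) (Fin p) ℝ :=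
  fun i j => if (i : ℕ) = (j : ℕ) then N i j * (Real.log (K i j) - Real.log (N i j))
    else K i j - N i j

/-- Gram-Schmidt with positive diagonal coefficients: a linearly independent family indexed by
`Fin p` in a `p`-dimensional space is triangular with positive diagonal with respect to some
orthonormal basis. -/
lemma exists_orthonormalBasis_triangular {E : Type*} [NormedAddCommGroup E]
    [InnerProductSpace ℝ E] [FiniteDimensional ℝ E] {p : ℕ} (hE : Module.finrank ℝ E = p)
    {f : Fin p → E} (hf : LinearIndependent ℝ f) :
    ∃ b : OrthonormalBasis (Fin p) ℝ E,
      (∀ i j, i < j → inner ℝ (f i) (b j) = 0) ∧ ∀ i, 0 < inner ℝ (f i) (b i) := by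
  have hcard : Module.finrank ℝ E = Fintype.card (Fin p) := by simpa using hE
  refine ⟨InnerProductSpace.gramSchmidtOrthonormalBasis hcard f, fun i j hij => ?_, fun i => ?_⟩
  · rw [real_inner_comm]
    exact InnerProductSpace.gramSchmidtOrthonormalBasis_inv_triangular hcard f hij
  · have hg := InnerProductSpace.gramSchmidt_ne_zero (𝕜 := ℝ) i hf
    have hn : InnerProductSpace.gramSchmidtNormed ℝ f i ≠ 0 := by
      simpa [InnerProductSpace.gramSchmidtNormed] using hg
    rw [InnerProductSpace.gramSchmidtOrthonormalBasis_apply hcard hn,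
      InnerProductSpace.gramSchmidtNormed, inner_smul_right]
    have hinner : inner ℝ (f i) (InnerProductSpace.gramSchmidt ℝ f i)
        = inner ℝ (InnerProductSpace.gramSchmidt ℝ f i)
          (InnerProductSpace.gramSchmidt ℝ f i) := by
      conv_lhs => rw [InnerProductSpace.gramSchmidt_def'' ℝ f i]
      rw [inner_add_left, sum_inner, Finset.sum_eq_zero, add_zero]
      intro k hk
      rw [inner_smul_left, InnerProductSpace.gramSchmidt_orthogonal ℝ f
        (Finset.mem_Iio.mp hk).ne, mul_zero]
    rw [hinner]
    exact mul_pos (inv_pos.mpr (norm_pos_iff.mpr hg)) (real_inner_self_pos.mpr hg)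

/-- A positive semidefinite matrix is the Gram matrix of vectors spanning a space whose dimension
is the rank of the matrix. -/
lemma Matrix.PosSemidef.exists_inner_eq {ι : Type*} [Fintype ι] [DecidableEq ι]
    {M : Matrix ι ι ℝ} (hM : M.PosSemidef) :
    ∃ v : ι → EuclideanSpace ℝ ι,
      Module.finrank ℝ (Submodule.span ℝ (Set.range v)) = M.rank ∧
        ∀ i j, M i j = inner ℝ (v i) (v j) := by
  obtain ⟨B, rfl⟩ : ∃ B : Matrix ι ι ℝ, M = Bᴴ * B := by
    open scoped MatrixOrder Matrix.Norms.L2Operator in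
    exact CStarAlgebra.nonneg_iff_eq_star_mul_self.mp hM.nonneg
  refine ⟨fun j => WithLp.toLp 2 (B.col j), ?_, fun i j => ?_⟩
  · rw [rank_conjTranspose_mul_self, rank_eq_finrank_span_cols]
    have hspan := Submodule.map_span (WithLp.linearEquiv 2 ℝ (ι → ℝ)).symm.toLinearMap
      (Set.range B.col)
    rw [← Set.range_comp] at hspan
    exact (congrArg (fun S : Submodule ℝ (EuclideanSpace ℝ ι) => Module.finrank ℝ S)
      hspan).symm.trans (LinearEquiv.finrank_map_eq _ _)
  · simp [Matrix.mul_apply, PiLp.inner_apply, mul_comm]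

/-- The reduced Cholesky factor is determined by the matrix. -/
lemma MemL.eq_of_mul_transpose_eq {n p : ℕ} (hpn : p ≤ n) {N K : Matrix (Fin n) (Fin p) ℝ}
    (hN : MemL n p N) (hK : MemL n p K) (h : N * Nᵀ = K * Kᵀ) : N = K := by
  suffices hcol : ∀ m (hm : m < p) i, N i ⟨m, hm⟩ = K i ⟨m, hm⟩ by
    ext i j
    exact hcol j j.2 i
  intro m
  induction m using Nat.strong_induction_on with
  | _ m ih =>
    intro hm
    let d : Fin n := ⟨m, hm.trans_le hpn⟩
    have hpivot : ∀ i, N i ⟨m, hm⟩ * N d ⟨m, hm⟩ = K i ⟨m, hm⟩ * K d ⟨m, hm⟩ := by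
      intro i
      have hid := congrFun (congrFun h i) d
      simp only [Matrix.mul_apply, Matrix.transpose_apply] at hid
      rw [← sub_eq_zero, ← Finset.sum_sub_distrib, Finset.sum_eq_single ⟨m, hm⟩] at hid
      · exact sub_eq_zero.mp hid
      · intro k _ hk
        rcases lt_or_gt_of_ne (fun e => hk (Fin.ext e) : (k : ℕ) ≠ m) with hlt | hgt
        · rw [ih k hlt k.2 i, ih k hlt k.2 d, sub_self]
        · rw [hN.1 d k hgt, hK.1 d k hgt, mul_zero, mul_zero, sub_self]
      · simp
    have hNd : 0 < N d ⟨m, hm⟩ := hN.2 d ⟨m, hm⟩ rfl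
    have hKd : 0 < K d ⟨m, hm⟩ := hK.2 d ⟨m, hm⟩ rfl
    have hd : N d ⟨m, hm⟩ = K d ⟨m, hm⟩ := (mul_self_inj hNd.le hKd.le).mp (hpivot d)
    intro i
    have hi := hpivot i
    rw [hd] at hi
    exact mul_right_cancel₀ hKd.ne' hi

/-- existence and uniqueness of the reduced Cholesky factor of `M ∈ S(n,p)*`. -/
theorem stmt0 (n p : ℕ) (hp : 1 ≤ p) (hpn : p < n)
    (M : Matrix (Fin n) (Fin n) ℝ) (hM : MemSStar n p M) :
    ∃! N : Matrix (Fin n) (Fin p) ℝ, MemL n p N ∧ M = N * Nᵀ := by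
  obtain ⟨⟨hpsd, hrank⟩, hind⟩ := hM
  obtain ⟨v, hv, hvM⟩ := hpsd.exists_inner_eq
  let W := Submodule.span ℝ (Set.range v)
  let w : Fin n → W := fun i => ⟨v i, Submodule.subset_span ⟨i, rfl⟩⟩
  have hw : ∀ i j, M i j = inner ℝ (w i) (w j) := hvM
  have hf : LinearIndependent ℝ (fun j : Fin p => w (j.castLE hpn.le)) := by
    let T : W →ₗ[ℝ] (Fin n → ℝ) := LinearMap.pi fun i => (innerSL ℝ (w i)).toLinearMap
    refine LinearIndependent.of_comp T ?_
    have hcols := hind.comp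
      (fun j : Fin p => (⟨j.castLE hpn.le, j.2⟩ : {j : Fin n // (j : ℕ) < p}))
      (fun a b hab => by simpa [Fin.ext_iff] using hab)
    convert hcols using 1
    ext j i
    simp [T, hw]
  obtain ⟨b, hlow, hdiag⟩ := exists_orthonormalBasis_triangular (hv.trans hrank) hf
  have hL : MemL n p (fun i j => inner ℝ (w i) (b j)) :=
    ⟨fun i j hij => hlow ⟨i, hij.trans j.2⟩ j hij, fun i j hij => by
      obtain rfl : i = j.castLE hpn.le := Fin.ext hij
      exact hdiag j⟩
  have hMN : M = Matrix.of (fun i j => inner ℝ (w i) (b j)) *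
      (Matrix.of fun i j => inner ℝ (w i) (b j))ᵀ := by
    ext i k
    rw [hw, ← b.sum_inner_mul_inner]
    simp only [Matrix.mul_apply, Matrix.transpose_apply, Matrix.of_apply]
    exact Finset.sum_congr rfl fun j _ => by rw [real_inner_comm (w k) (b j)]
  exact ⟨_, ⟨hL, hMN⟩, fun K hK => hK.1.eq_of_mul_transpose_eq hpn.le hL (hK.2.symm.trans hMN)⟩
end

section
/- Let M be a real n×n positive semidefinite matrix and let L be a real n×n lower triangular matrix with nonnegative diagonal entries such that M = L Lᵀ and such that for every index i, if L_{ii} = 0 then the entire i-th column of L is zero. Then for every index i, the i-th column of M is a linear combination of the columns 1,…,i−1 of M if and only if the i-th column of L is the zero column. -/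
open Matrix BigOperators

/-- Every column of a triangular factor `L` lies in the span of the columns of `L * Lᵀ` up to
the same index, provided that columns of `L` with zero diagonal entry vanish. -/
theorem col_mem_span_col_mul_transpose {n : ℕ} (L : Matrix (Fin n) (Fin n) ℝ)
    (hLtri : ∀ i j : Fin n, i < j → L i j = 0)
    (hzerocol : ∀ i : Fin n, L i i = 0 → ∀ r : Fin n, L r i = 0) (i k : Fin n) (hk : k < i) :
    (fun r => L r k) ∈ Submodule.span ℝ
      {v : Fin n → ℝ | ∃ j : Fin n, j < i ∧ v = fun r => (L * Lᵀ) r j} := by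
  induction k using WellFoundedLT.induction with
  | ind k ih =>
    by_cases h0 : L k k = 0
    · have hz : (fun r => L r k) = 0 := funext (hzerocol k h0)
      rw [hz]
      exact Submodule.zero_mem _
    · have hcol : (fun r => L r k) = (L k k)⁻¹ • ((fun r => (L * Lᵀ) r k) -
          ∑ m ∈ Finset.univ.erase k, L k m • fun r => L r m) := by
        funext r
        have hsum := Finset.add_sum_erase Finset.univ (fun m => L k m * L r m)
          (Finset.mem_univ k)
        have hM : (L * Lᵀ) r k = ∑ m, L k m * L r m := by
          simp [Matrix.mul_apply, mul_comm]
        simp only [Pi.smul_apply, Pi.sub_apply, Finset.sum_apply, smul_eq_mul, hM, ← hsum]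
        field_simp
        ring
      rw [hcol]
      refine Submodule.smul_mem _ _ (Submodule.sub_mem _
        (Submodule.subset_span ⟨k, hk, rfl⟩) (Submodule.sum_mem _ fun m hm => ?_))
      rcases lt_or_gt_of_ne (Finset.ne_of_mem_erase hm) with h | h
      · exact Submodule.smul_mem _ _ (ih m h (h.trans hk))
      · rw [hLtri k m h, zero_smul]
        exact Submodule.zero_mem _

/-- A vector in the span of the columns of `M` before index `i` is `M *ᵥ c` for some `c`
supported before `i`. -/
theorem exists_mulVec_of_mem_span_col {n : ℕ} (M : Matrix (Fin n) (Fin n) ℝ) (i : Fin n)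
    (v : Fin n → ℝ)
    (hv : v ∈ Submodule.span ℝ {v : Fin n → ℝ | ∃ j : Fin n, j < i ∧ v = fun r => M r j}) :
    ∃ c : Fin n → ℝ, (∀ r, i ≤ r → c r = 0) ∧ M *ᵥ c = v := by
  induction hv using Submodule.span_induction with
  | mem x hx =>
    obtain ⟨j, hj, rfl⟩ := hx
    exact ⟨Pi.single j 1, fun r hr => Pi.single_eq_of_ne (hj.trans_le hr).ne' _,
      Matrix.mulVec_single_one M j⟩
  | zero => exact ⟨0, fun _ _ => rfl, Matrix.mulVec_zero M⟩
  | add x y _ _ hx hy =>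
    obtain ⟨c, hc, rfl⟩ := hx
    obtain ⟨d, hd, rfl⟩ := hy
    exact ⟨c + d, fun r hr => by simp [hc r hr, hd r hr], Matrix.mulVec_add M c d⟩
  | smul a x _ hx =>
    obtain ⟨c, hc, rfl⟩ := hx
    exact ⟨a • c, fun r hr => by simp [hc r hr], Matrix.mulVec_smul M a c⟩

/-- zero columns of the Cholesky factor correspond exactly to columns of `M`
that are linear combinations of the previous columns. -/
theorem stmt1 (n : ℕ) (M L : Matrix (Fin n) (Fin n) ℝ)
    (hM : M.PosSemidef)
    (hLtri : ∀ i j : Fin n, i < j → L i j = 0)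
    (hLdiag : ∀ i : Fin n, 0 ≤ L i i)
    (hfact : M = L * Lᵀ)
    (hzerocol : ∀ i : Fin n, L i i = 0 → ∀ r : Fin n, L r i = 0) :
    ∀ i : Fin n,
      ((fun r => M r i) ∈
        Submodule.span ℝ {v : Fin n → ℝ | ∃ j : Fin n, j < i ∧ v = fun r => M r j})
      ↔ (∀ r : Fin n, L r i = 0) := by
  subst hfact
  intro i
  constructor
  · intro h
    obtain ⟨c, hc, hcM⟩ := exists_mulVec_of_mem_span_col _ i _ h
    have hker : (L * Lᵀ) *ᵥ (Pi.single i 1 - c) = 0 := by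
      rw [Matrix.mulVec_sub, hcM, Matrix.mulVec_single_one]
      exact sub_self _
    have hLker : Lᵀ *ᵥ (Pi.single i 1 - c) = 0 := by
      rw [← dotProduct_self_eq_zero, Matrix.dotProduct_mulVec, Matrix.vecMul_transpose,
        Matrix.mulVec_mulVec, hker, zero_dotProduct]
    apply hzerocol
    have hi := congrFun hLker i
    rw [Matrix.mulVec, dotProduct, Finset.sum_eq_single i] at hi
    · simpa [hc i le_rfl] using hi
    · intro r _ hr
      rcases lt_or_gt_of_ne hr with h | h
      · simp [hLtri r i h]
      · simp [hc r h.le, hr]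
    · simp
  · intro h
    have hcol : (fun r => (L * Lᵀ) r i) = ∑ m, L i m • fun r => L r m := by
      funext r
      simp [Matrix.mul_apply, mul_comm]
    rw [hcol]
    refine Submodule.sum_mem _ fun m _ => ?_
    rcases lt_or_ge m i with hm | hm
    · exact Submodule.smul_mem _ _ (col_mem_span_col_mul_transpose L hLtri hzerocol i m hm)
    · have hz : L i m = 0 := by
        rcases hm.eq_or_lt with rfl | hm
        · exact h i
        · exact hLtri i m hm
      rw [hz, zero_smul]
      exact Submodule.zero_mem _
end

section
/- S(n,p)* is dense in S(n,p) with respect to the Frobenius norm: for every M ∈ S(n,p) and every ε > 0 there exists M' ∈ S(n,p)* with ‖M − M'‖_F < ε. -/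
open Matrix BigOperators

/-- A real positive semidefinite matrix of rank `p` factors as `A * Aᵀ` with `A` having `p`
columns. -/
theorem Matrix.PosSemidef.exists_mul_transpose_of_rank_eq {m : Type*} [Fintype m] [DecidableEq m]
    {M : Matrix m m ℝ} (hM : M.PosSemidef) {p : ℕ} (hr : M.rank = p) :
    ∃ A : Matrix m (Fin p) ℝ, M = A * Aᵀ := by
  have hH := hM.isHermitian
  have hcard : Fintype.card {k // hH.eigenvalues k ≠ 0} = p := by
    rw [← hr, hH.rank_eq_card_non_zero_eigs]
  let e := (Fintype.equivFinOfCardEq hcard).symm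
  let U : Matrix m m ℝ := hH.eigenvectorUnitary
  refine ⟨Matrix.of fun i k => U i (e k) * √(hH.eigenvalues (e k)), ?_⟩
  ext i j
  have hentry : M i j = ∑ k, U i k * hH.eigenvalues k * U j k := by
    conv_lhs => rw [hH.spectral_theorem, Unitary.conjStarAlgAut_apply]
    rw [Matrix.mul_apply]
    simp [Matrix.mul_diagonal, Matrix.star_apply, U]
  have hterm : ∀ k, U i (e k) * √(hH.eigenvalues (e k)) * (U j (e k) * √(hH.eigenvalues (e k))) =
      U i (e k) * hH.eigenvalues (e k) * U j (e k) := fun k => by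
    have := Real.mul_self_sqrt (hM.eigenvalues_nonneg (e k))
    linear_combination U i (e k) * U j (e k) * this
  simp only [Matrix.mul_apply, Matrix.transpose_apply, Matrix.of_apply, hterm]
  rw [hentry, e.sum_comp (fun k : {k // hH.eigenvalues k ≠ 0} => U i k * hH.eigenvalues k * U j k)]
  rw [← Finset.sum_subtype (Finset.univ.filter fun k => hH.eigenvalues k ≠ 0) (by simp)
    fun k => U i k * hH.eigenvalues k * U j k]
  refine (Finset.sum_filter_of_ne fun k _ hk => ?_).symm
  exact right_ne_zero_of_mul (left_ne_zero_of_mul hk)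

/-- Adding a small multiple of the identity makes a square matrix nonsingular. -/
theorem Matrix.eventually_det_add_smul_one_ne_zero {m : Type*} [Fintype m] [DecidableEq m]
    (B : Matrix m m ℝ) : ∀ᶠ t in nhdsWithin (0 : ℝ) {0}ᶜ, (B + t • (1 : Matrix m m ℝ)).det ≠ 0 := by
  have hfin : {t | (-B).charpoly.IsRoot t}.Finite :=
    Polynomial.finite_setOfPred_isRoot (Matrix.charpoly_monic _).ne_zero
  filter_upwards [nhdsNE_le_cofinite _ hfin.compl_mem_cofinite] with t ht hdet
  apply ht
  rw [Set.mem_ofPred_eq, Polynomial.IsRoot, Matrix.eval_charpoly, ← hdet]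
  congr 1
  rw [Matrix.scalar_apply, ← Matrix.smul_one_eq_diagonal, sub_neg_eq_add, add_comm]

/-- If the top `p × p` block of `A` is nonsingular, then `A * Aᵀ` belongs to `S(n,p)*`. -/
theorem memSStar_mul_transpose {n p : ℕ} (hpn : p ≤ n) (A : Matrix (Fin n) (Fin p) ℝ)
    (hA : (A.submatrix (Fin.castLE hpn) id).det ≠ 0) : MemSStar n p (A * Aᵀ) := by
  set B := A.submatrix (Fin.castLE hpn) id with hB
  have hBu : IsUnit B := (Matrix.isUnit_iff_isUnit_det _).2 hA.isUnit
  refine ⟨⟨by simpa using Matrix.posSemidef_self_mul_conjTranspose A, ?_⟩, ?_⟩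
  · rw [Matrix.rank_self_mul_transpose]
    refine le_antisymm A.rank_le_width ?_
    calc p = B.rank := by rw [Matrix.rank_of_isUnit _ hBu, Fintype.card_fin]
      _ ≤ A.rank := A.rank_submatrix_le _ _
  · have hcols : LinearIndependent ℝ (B * Bᵀ).col :=
      Matrix.linearIndependent_cols_iff_isUnit.2 (hBu.mul ((Matrix.isUnit_transpose _).2 hBu))
    have hcols' : LinearIndependent ℝ
        (fun (j : Fin p) (i : Fin n) => (A * Aᵀ) i (Fin.castLE hpn j)) :=
      LinearIndependent.of_comp (LinearMap.funLeft ℝ ℝ (Fin.castLE hpn)) hcols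
    exact hcols'.comp (fun j : {j : Fin n // (j : ℕ) < p} => ⟨j.1, j.2⟩)
      fun a b hab => Subtype.ext (Fin.ext (Fin.mk.inj hab))

/-- `S(n,p)*` is dense in `S(n,p)` for the Frobenius norm. -/
theorem stmt3 (n p : ℕ) (hp : 1 ≤ p) (hpn : p < n)
    (M : Matrix (Fin n) (Fin n) ℝ) (hM : MemS n p M) (ε : ℝ) (hε : 0 < ε) :
    ∃ M' : Matrix (Fin n) (Fin n) ℝ, MemSStar n p M' ∧ frobNorm n (M - M') < ε := by
  obtain ⟨A, rfl⟩ := hM.1.exists_mul_transpose_of_rank_eq hM.2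
  let J : Matrix (Fin n) (Fin p) ℝ := (1 : Matrix (Fin n) (Fin n) ℝ).submatrix id (Fin.castLE hpn.le)
  have hJ : J.submatrix (Fin.castLE hpn.le) id = 1 :=
    Matrix.submatrix_one _ (Fin.castLE_injective hpn.le)
  have hcont : Continuous fun t : ℝ => frobNorm n (A * Aᵀ - (A + t • J) * (A + t • J)ᵀ) := by
    unfold frobNorm
    simp only [Matrix.sub_apply, Matrix.mul_apply, Matrix.transpose_apply, Matrix.add_apply,
      Matrix.smul_apply]
    fun_prop
  have hsmall : ∀ᶠ t in nhdsWithin (0 : ℝ) {0}ᶜ,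
      frobNorm n (A * Aᵀ - (A + t • J) * (A + t • J)ᵀ) < ε :=
    (hcont.continuousAt.eventually_lt_const (by simpa [frobNorm] using hε)).filter_mono
      nhdsWithin_le_nhds
  obtain ⟨t, hdet, ht⟩ :=
    ((A.submatrix (Fin.castLE hpn.le) id).eventually_det_add_smul_one_ne_zero.and hsmall).exists
  refine ⟨_, memSStar_mul_transpose hpn.le (A + t • J) ?_, ht⟩
  rwa [Matrix.submatrix_add, Matrix.submatrix_smul, Pi.add_apply, Pi.add_apply,
    Pi.smul_apply, Pi.smul_apply, hJ]
end

section
/- Let N be a real n×p matrix with N_{ij} = 0 whenever i < j and N_{ii} > 0 for all i = 1,…,p, and let X be a real n×p matrix with X_{ij} = 0 whenever i < j. If the n×n matrix N Xᵀ is skew-symmetric, i.e. (N Xᵀ)ᵀ = −N Xᵀ, then X = 0. -/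
open Matrix BigOperators

/-- The `i, k` entry of `N Yᵀ` reduces to one product when `N` is mock lower triangular and the
columns of `Y` before the `k`-th vanish. -/
lemma MockLower.mul_transpose_apply_of_cols_eq_zero {n p : ℕ} {N Y : Matrix (Fin n) (Fin p) ℝ}
    (hN : MockLower n p N) {l : Fin n} {k : Fin p} (hlk : (l : ℕ) = k)
    (hY : ∀ j < k, ∀ i, Y i j = 0) (i : Fin n) : (N * Yᵀ) l i = N l k * Y i k := by
  rw [Matrix.mul_apply, Finset.sum_eq_single k _ (by simp)]
  · rfl
  · intro j _ hjk
    rcases lt_or_gt_of_ne hjk with h | h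
    · simp [hY j h i]
    · simp [hN l j (hlk.trans_lt h)]

/-- if `N ∈ L^{n×p}_*`, `X` is mock lower triangular and `N Xᵀ` is
skew-symmetric, then `X = 0`. -/
theorem stmt6 (n p : ℕ) (N X : Matrix (Fin n) (Fin p) ℝ)
    (hN : MemL n p N) (hX : MockLower n p X)
    (hskew : (N * Xᵀ)ᵀ = -(N * Xᵀ)) : X = 0 := by
  have hcol : ∀ k : Fin p, ∀ i, X i k = 0 := by
    intro k
    induction k using WellFoundedLT.induction with
    | ind k ih =>
      rcases le_or_gt n k with hk | hk
      · exact fun i => hX i k (i.isLt.trans_le hk)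
      let l : Fin n := ⟨k, hk⟩
      have hpos : 0 < N l k := hN.2 l k rfl
      have hNX := hN.1.mul_transpose_apply_of_cols_eq_zero (l := l) rfl ih
      have hXN : ∀ i, (N * Xᵀ) i l = X l k * N i k := fun i => by
        rw [Matrix.mul_apply, Finset.sum_eq_single k _ (by simp)]
        · exact mul_comm _ _
        · intro j _ hjk
          rcases lt_or_gt_of_ne hjk with h | h
          · simp [ih j h l]
          · simp [hX l j h]
      have hsum : ∀ i, X l k * N i k = -(N l k * X i k) := fun i => by
        rw [← hXN, ← hNX]
        exact congrFun (congrFun hskew l) i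
      have hdiag : X l k = 0 := by
        have h : N l k * X l k = 0 := by linarith [hsum l]
        exact (mul_eq_zero.mp h).resolve_left hpos.ne'
      intro i
      have h : N l k * X i k = 0 := by simpa [hdiag] using hsum i
      exact (mul_eq_zero.mp h).resolve_left hpos.ne'
  ext i k
  exact hcol k i
end

section
/- Let N ∈ L^{n×p}_*. Then the linear map sending a mock lower triangular n×p matrix X to the symmetric n×n matrix X Nᵀ + N Xᵀ is injective: if X and Y are mock lower triangular n×p matrices with X Nᵀ + N Xᵀ = Y Nᵀ + N Yᵀ, then X = Y. -/
open Matrix BigOperators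

/-- On mock lower triangular matrices, the linear map `D ↦ D Nᵀ + N Dᵀ` has trivial kernel when
`N ∈ L^{n×p}_*`. -/
theorem MockLower.eq_zero_of_mul_transpose_add {n p : ℕ} {N D : Matrix (Fin n) (Fin p) ℝ}
    (hN : MemL n p N) (hD : MockLower n p D) (h : D * Nᵀ + N * Dᵀ = 0) : D = 0 := by
  suffices H : ∀ (m : ℕ) (j : Fin p), (j : ℕ) = m → ∀ i, D i j = 0 by
    ext i j
    exact H j j rfl i
  intro m
  induction m using Nat.strong_induction_on with
  | _ m ih =>
    rintro j rfl i
    rcases lt_or_ge (i : ℕ) j with hij | hji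
    · exact hD i j hij
    let d : Fin n := ⟨j, hji.trans_lt i.isLt⟩
    have hpos : 0 < N d j := hN.2 d j rfl
    -- only the `j`-th summand survives in column `d`
    have key : ∀ r, D r j * N d j + N r j * D d j = 0 := by
      intro r
      have hr := congrFun (congrFun h r) d
      simp only [Matrix.add_apply, Matrix.mul_apply, Matrix.transpose_apply, Matrix.zero_apply,
        ← Finset.sum_add_distrib] at hr
      rwa [Finset.sum_eq_single j] at hr
      · intro k _ hk
        rcases lt_or_gt_of_ne (Fin.val_ne_of_ne hk) with hlt | hgt
        · simp [ih k hlt k rfl]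
        · simp [hN.1 d k hgt, hD d k hgt]
      · simp
    have hd : D d j = 0 :=
      (mul_eq_zero.mp (show D d j * N d j = 0 by linarith [key d])).resolve_right hpos.ne'
    have hi := key i
    rw [hd, mul_zero, add_zero] at hi
    simpa [hpos.ne'] using hi

/-- for `N ∈ L^{n×p}_*`, the map `X ↦ X Nᵀ + N Xᵀ` is injective on mock lower
triangular matrices. -/
theorem stmt7 (n p : ℕ) (N X Y : Matrix (Fin n) (Fin p) ℝ)
    (hN : MemL n p N) (hX : MockLower n p X) (hY : MockLower n p Y)
    (h : X * Nᵀ + N * Xᵀ = Y * Nᵀ + N * Yᵀ) : X = Y := by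
  refine sub_eq_zero.mp (MockLower.eq_zero_of_mul_transpose_add hN ?_ ?_)
  · intro i j hij
    simp [hX i j hij, hY i j hij]
  · rw [Matrix.transpose_sub, Matrix.sub_mul, Matrix.mul_sub, sub_add_sub_comm, h, sub_self]
end

section
/- The function d̃ defined by d̃(N,K) = ( Σ_{i>j} (N_{ij} − K_{ij})² + Σ_{i=1}^p (log N_{ii} − log K_{ii})² )^{1/2} is a metric on L^{n×p}_*, and consequently the function d defined on S(n,p)* by d(P,Q) = d̃(N_P, N_Q), where N_P and N_Q are the reduced Cholesky factors of P and Q, is a metric on S(n,p)*: both are nonnegative, vanish exactly on equal pairs, are symmetric, and satisfy the triangle inequality. -/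
open Matrix BigOperators

/-- The coordinates in which `dL` is the Euclidean distance: entries below the mock diagonal,
logarithms of the entries on it. -/
noncomputable def logCoord (n p : ℕ) (N : Matrix (Fin n) (Fin p) ℝ) :
    EuclideanSpace ℝ (Fin n × Fin p) :=
  WithLp.toLp 2 fun ij =>
    if (ij.2 : ℕ) < (ij.1 : ℕ) then N ij.1 ij.2
    else if (ij.1 : ℕ) = (ij.2 : ℕ) then Real.log (N ij.1 ij.2) else 0

lemma dL_eq_dist_logCoord (n p : ℕ) (N K : Matrix (Fin n) (Fin p) ℝ) :
    dL n p N K = dist (logCoord n p N) (logCoord n p K) := by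
  rw [EuclideanSpace.dist_eq, dL, Fintype.sum_prod_type]
  congr 1
  simp only [← Finset.sum_add_distrib]
  refine Finset.sum_congr rfl fun i _ => Finset.sum_congr rfl fun j _ => ?_
  rcases lt_trichotomy (i : ℕ) j with h | h | h
  · simp [logCoord, h.not_gt, h.ne]
  · simp [logCoord, h, Real.dist_eq, sq_abs]
  · simp [logCoord, h, h.ne', Real.dist_eq, sq_abs]

lemma logCoord_injOn (n p : ℕ) : Set.InjOn (logCoord n p) {N | MemL n p N} := by
  intro N hN K hK h
  ext i j
  have hij : logCoord n p N (i, j) = logCoord n p K (i, j) := by rw [h]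
  rcases lt_trichotomy (i : ℕ) j with hlt | heq | hgt
  · rw [hN.1 i j hlt, hK.1 i j hlt]
  · exact Real.log_injOn_pos (hN.2 i j heq) (hK.2 i j heq) (by simpa [logCoord, heq] using hij)
  · simpa [logCoord, hgt] using hij

lemma dL_eq_zero_iff {n p : ℕ} {N K : Matrix (Fin n) (Fin p) ℝ} (hN : MemL n p N)
    (hK : MemL n p K) : dL n p N K = 0 ↔ N = K := by
  rw [dL_eq_dist_logCoord, dist_eq_zero]
  exact (logCoord_injOn n p).eq_iff hN hK

lemma dL_comm (n p : ℕ) (N K : Matrix (Fin n) (Fin p) ℝ) : dL n p N K = dL n p K N := by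
  simp only [dL_eq_dist_logCoord, dist_comm]

lemma dL_triangle (n p : ℕ) (N K H : Matrix (Fin n) (Fin p) ℝ) :
    dL n p N H ≤ dL n p N K + dL n p K H := by
  simpa only [dL_eq_dist_logCoord] using dist_triangle _ _ _

/-- `d̃` is a metric on `L^{n×p}_*` and the induced `d` is a metric
on `S(n,p)*`. -/
theorem stmt10 (n p : ℕ) (hp : 1 ≤ p) (hpn : p < n)
    (chol : Matrix (Fin n) (Fin n) ℝ → Matrix (Fin n) (Fin p) ℝ)
    (hchol : ∀ M, MemSStar n p M → MemL n p (chol M) ∧ M = chol M * (chol M)ᵀ) :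
    ((∀ N K, MemL n p N → MemL n p K → 0 ≤ dL n p N K) ∧
     (∀ N K, MemL n p N → MemL n p K → (dL n p N K = 0 ↔ N = K)) ∧
     (∀ N K, MemL n p N → MemL n p K → dL n p N K = dL n p K N) ∧
     (∀ N K H, MemL n p N → MemL n p K → MemL n p H →
       dL n p N H ≤ dL n p N K + dL n p K H)) ∧
    ((∀ P Q, MemSStar n p P → MemSStar n p Q → 0 ≤ dL n p (chol P) (chol Q)) ∧
     (∀ P Q, MemSStar n p P → MemSStar n p Q →
       (dL n p (chol P) (chol Q) = 0 ↔ P = Q)) ∧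
     (∀ P Q, MemSStar n p P → MemSStar n p Q →
       dL n p (chol P) (chol Q) = dL n p (chol Q) (chol P)) ∧
     (∀ P Q R, MemSStar n p P → MemSStar n p Q → MemSStar n p R →
       dL n p (chol P) (chol R)
         ≤ dL n p (chol P) (chol Q) + dL n p (chol Q) (chol R))) := by
  refine ⟨⟨fun N K _ _ => Real.sqrt_nonneg _, fun N K hN hK => dL_eq_zero_iff hN hK,
    fun N K _ _ => dL_comm n p N K, fun N K H _ _ _ => dL_triangle n p N K H⟩,
    fun P Q _ _ => Real.sqrt_nonneg _, fun P Q hP hQ => ?_,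
    fun P Q _ _ => dL_comm n p _ _, fun P Q R _ _ _ => dL_triangle n p _ _ _⟩
  rw [dL_eq_zero_iff (hchol P hP).1 (hchol Q hQ).1]
  refine ⟨fun h => ?_, fun h => by rw [h]⟩
  rw [(hchol P hP).2, (hchol Q hQ).2, h]
end

section
/- Let N, K ∈ L^{n×p}_* and for t ∈ ℝ define γ(t) by γ(t)_{ii} = N_{ii}^{1−t} K_{ii}^{t} for i = 1,…,p and γ(t)_{ij} = (1−t)N_{ij} + t K_{ij} for i > j (and zero above the mock diagonal). Then γ(t) ∈ L^{n×p}_* for all t ∈ ℝ, γ(0) = N, γ(1) = K, and for all s, t ∈ ℝ one has d̃(γ(s), γ(t)) = |s − t| · d̃(N, K); in particular γ is a constant-speed geodesic of the metric d̃ joining N to K. -/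
open Matrix BigOperators

theorem log_rpow_mul_rpow {a b : ℝ} (ha : 0 < a) (hb : 0 < b) (s t : ℝ) :
    Real.log (a ^ s * b ^ t) = s * Real.log a + t * Real.log b := by
  rw [Real.log_mul (Real.rpow_pos_of_pos ha s).ne' (Real.rpow_pos_of_pos hb t).ne',
    Real.log_rpow ha, Real.log_rpow hb]

theorem memL_geo {n p : ℕ} {N K : Matrix (Fin n) (Fin p) ℝ}
    (hN : MemL n p N) (hK : MemL n p K) (t : ℝ) : MemL n p (geo n p N K t) := by
  refine ⟨fun i j hij => ?_, fun i j hij => ?_⟩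
  · simp [geo, hij.ne, hN.1 i j hij, hK.1 i j hij]
  · simp only [geo, hij, if_true]
    exact mul_pos (Real.rpow_pos_of_pos (hN.2 i j hij) _) (Real.rpow_pos_of_pos (hK.2 i j hij) _)

theorem geo_zero (n p : ℕ) (N K : Matrix (Fin n) (Fin p) ℝ) : geo n p N K 0 = N := by
  ext i j
  simp [geo]

theorem geo_one (n p : ℕ) (N K : Matrix (Fin n) (Fin p) ℝ) : geo n p N K 1 = K := by
  ext i j
  simp [geo]

theorem dL_geo {n p : ℕ} {N K : Matrix (Fin n) (Fin p) ℝ}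
    (hN : MemL n p N) (hK : MemL n p K) (s t : ℝ) :
    dL n p (geo n p N K s) (geo n p N K t) = |s - t| * dL n p N K := by
  unfold dL
  rw [← Real.sqrt_sq_eq_abs, ← Real.sqrt_mul (sq_nonneg _), mul_add]
  simp only [Finset.mul_sum]
  congr 2 <;> refine Finset.sum_congr rfl fun i _ => Finset.sum_congr rfl fun j _ => ?_
  · split_ifs with h
    · simp only [geo, h.ne', if_false]
      ring
    · simp
  · split_ifs with h
    · simp only [geo, h, if_true]
      rw [log_rpow_mul_rpow (hN.2 i j h) (hK.2 i j h), log_rpow_mul_rpow (hN.2 i j h) (hK.2 i j h)]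
      ring
    · simp

/-- `γ` is a constant-speed geodesic of `d̃` joining `N` to `K`
in `L^{n×p}_*`. -/
theorem stmt11 (n p : ℕ) (N K : Matrix (Fin n) (Fin p) ℝ)
    (hN : MemL n p N) (hK : MemL n p K) :
    (∀ t : ℝ, MemL n p (geo n p N K t)) ∧
    geo n p N K 0 = N ∧ geo n p N K 1 = K ∧
    (∀ s t : ℝ, dL n p (geo n p N K s) (geo n p N K t) = |s - t| * dL n p N K) := by
  exact ⟨memL_geo hN hK, geo_zero n p N K, geo_one n p N K, dL_geo hN hK⟩
end
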